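/- Let n = 2 and λ₁ > λ₂ > 0. For every x⁰ ∈ ℝ² with both coordinates nonzero (i.e. x⁰ not an eigenvector of A = diag(λ₁,λ₂)), the rate of convergence of exact line search gradient descent equals the one-step shrinking factor of the seed: ρ*(x⁰,λ) = ρ(x⁰,λ). Moreover ρ(GD(x⁰),λ) = ρ(x⁰,λ). -/

import Mathlib

open MeasureTheory Filter Finset Real Metric

noncomputable section

/-- `qform lam k x = xᵀ Aᵏ x` for `A = diag lam`. -/
def qform {n : ℕ} (lam : Fin n → ℝ) (k : ℕ) (x : Fin n → ℝ) : ℝ :=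
  ∑ i, lam i ^ k * x i ^ 2

/-- Exact line search gradient descent map for `f(x) = ½ xᵀAx`, `A = diag lam`;
`GD 0 = 0`. -/
def GD {n : ℕ} (lam : Fin n → ℝ) (x : Fin n → ℝ) : Fin n → ℝ :=
  if x = 0 then 0 else fun i => x i - qform lam 2 x / qform lam 3 x * (lam i * x i)

/-- One-step shrinking factor `ρ(x, λ)`, with the convention `ρ(0, λ) = 0`. -/
def shrink {n : ℕ} (lam : Fin n → ℝ) (x : Fin n → ℝ) : ℝ :=
  if x = 0 then 0 else
    Real.sqrt (1 - (qform lam 2 x) ^ 2 / (qform lam 1 x * qform lam 3 x))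

/-- Rate of convergence `ρ*(x⁰, λ)` of exact line search gradient descent from seed `x⁰`. -/
def rocGD {n : ℕ} (lam : Fin n → ℝ) (x0 : Fin n → ℝ) : ℝ :=
  Filter.limsup
    (fun k : ℕ => (∏ j ∈ Finset.range k, shrink lam ((GD lam)^[j] x0)) ^ ((k : ℝ)⁻¹))
    Filter.atTop

theorem qform_two_dim (lam x : Fin 2 → ℝ) (k : ℕ) :
    qform lam k x = lam 0 ^ k * x 0 ^ 2 + lam 1 ^ k * x 1 ^ 2 := by
  simp [qform, Fin.sum_univ_two]

theorem ne_zero_of_apply_ne_zero {n : ℕ} {x : Fin n → ℝ} {i : Fin n} (h : x i ≠ 0) : x ≠ 0 :=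
  fun hx => h (congrFun hx i)

theorem qform_two_dim_pos {lam x : Fin 2 → ℝ} (hlam0 : 0 < lam 0) (hlam1 : 0 < lam 1)
    (h0 : x 0 ≠ 0) (k : ℕ) : 0 < qform lam k x := by
  rw [qform_two_dim]
  positivity

/-- The first coordinate after one exact line search step in dimension two. -/
theorem GD_two_dim_zero {lam x : Fin 2 → ℝ} (hlam0 : 0 < lam 0) (hlam1 : 0 < lam 1)
    (h0 : x 0 ≠ 0) :
    GD lam x 0 = -((lam 0 - lam 1) / qform lam 3 x) * (lam 1 ^ 2 * x 1 ^ 2 * x 0) := by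
  have h3 := (qform_two_dim_pos hlam0 hlam1 h0 3).ne'
  rw [GD, if_neg (ne_zero_of_apply_ne_zero h0)]
  field_simp
  simp only [qform_two_dim]
  ring

/-- The second coordinate after one exact line search step in dimension two. -/
theorem GD_two_dim_one {lam x : Fin 2 → ℝ} (hlam0 : 0 < lam 0) (hlam1 : 0 < lam 1)
    (h0 : x 0 ≠ 0) :
    GD lam x 1 = (lam 0 - lam 1) / qform lam 3 x * (lam 0 ^ 2 * x 0 ^ 2 * x 1) := by
  have h3 := (qform_two_dim_pos hlam0 hlam1 h0 3).ne'
  rw [GD, if_neg (ne_zero_of_apply_ne_zero h0)]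
  field_simp
  simp only [qform_two_dim]
  ring

theorem GD_two_dim_ne_zero {lam x : Fin 2 → ℝ} (hord : lam 1 < lam 0) (hpos : 0 < lam 1)
    (h0 : x 0 ≠ 0) (h1 : x 1 ≠ 0) : GD lam x 0 ≠ 0 ∧ GD lam x 1 ≠ 0 := by
  have hlam0 := hpos.trans hord
  have h3 := (qform_two_dim_pos hlam0 hpos h0 3).ne'
  have hsub : lam 0 - lam 1 ≠ 0 := sub_ne_zero.2 hord.ne'
  have hl0 := hlam0.ne'
  have hl1 := hpos.ne'
  rw [GD_two_dim_zero hlam0 hpos h0, GD_two_dim_one hlam0 hpos h0]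
  simp [h0, h1, h3, hsub, hl0, hl1]

/-- In dimension two the shrinking factor is invariant under one gradient descent step. -/
theorem shrink_GD_two_dim {lam x : Fin 2 → ℝ} (hord : lam 1 < lam 0) (hpos : 0 < lam 1)
    (h0 : x 0 ≠ 0) (h1 : x 1 ≠ 0) : shrink lam (GD lam x) = shrink lam x := by
  have hlam0 := hpos.trans hord
  have hsub : lam 0 - lam 1 ≠ 0 := sub_ne_zero.2 hord.ne'
  have hq := fun k => (qform_two_dim_pos hlam0 hpos h0 k).ne'
  have hl0 := hlam0.ne'
  have hl1 := hpos.ne'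
  obtain ⟨c, hc, hc0⟩ : ∃ c, c = (lam 0 - lam 1) / qform lam 3 x * (x 0 * x 1) ∧ c ≠ 0 :=
    ⟨_, rfl, mul_ne_zero (div_ne_zero hsub (hq 3)) (mul_ne_zero h0 h1)⟩
  have e1 : qform lam 1 (GD lam x) = c ^ 2 * (lam 0 * lam 1) * qform lam 3 x := by
    rw [qform_two_dim, GD_two_dim_zero hlam0 hpos h0, GD_two_dim_one hlam0 hpos h0, hc,
      qform_two_dim lam x 3]
    ring
  have e2 : qform lam 2 (GD lam x) = c ^ 2 * (lam 0 * lam 1) ^ 2 * qform lam 2 x := by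
    rw [qform_two_dim, GD_two_dim_zero hlam0 hpos h0, GD_two_dim_one hlam0 hpos h0, hc,
      qform_two_dim lam x 2]
    ring
  have e3 : qform lam 3 (GD lam x) = c ^ 2 * (lam 0 * lam 1) ^ 3 * qform lam 1 x := by
    rw [qform_two_dim, GD_two_dim_zero hlam0 hpos h0, GD_two_dim_one hlam0 hpos h0, hc,
      qform_two_dim lam x 1]
    ring
  have hq1 := hq 1
  have hq3 := hq 3
  rw [shrink, shrink, if_neg (ne_zero_of_apply_ne_zero h0),
    if_neg (ne_zero_of_apply_ne_zero (GD_two_dim_ne_zero hord hpos h0 h1).1), e1, e2, e3]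
  congr 2
  field_simp

theorem shrink_iterate_GD_two_dim {lam x : Fin 2 → ℝ} (hord : lam 1 < lam 0) (hpos : 0 < lam 1)
    (h0 : x 0 ≠ 0) (h1 : x 1 ≠ 0) (j : ℕ) : shrink lam ((GD lam)^[j] x) = shrink lam x := by
  induction j generalizing x with
  | zero => rfl
  | succ j ih =>
    obtain ⟨h0', h1'⟩ := GD_two_dim_ne_zero hord hpos h0 h1
    rw [Function.iterate_succ_apply, ih h0' h1', shrink_GD_two_dim hord hpos h0 h1]

theorem shrink_nonneg {n : ℕ} (lam x : Fin n → ℝ) : 0 ≤ shrink lam x := by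
  rw [shrink]
  split_ifs
  · exact le_rfl
  · exact Real.sqrt_nonneg _

/-- in dimension 2, the ROC of exact line search gradient descent from any
seed with both coordinates nonzero equals the one-step shrinking factor of the seed, and
the shrinking factor is invariant along the iteration. -/
theorem rocGD_eq_shrink_two_dim (lam : Fin 2 → ℝ) (hord : lam 1 < lam 0)
    (hpos : 0 < lam 1) (x0 : Fin 2 → ℝ) (h0 : x0 0 ≠ 0) (h1 : x0 1 ≠ 0) :
    rocGD lam x0 = shrink lam x0 ∧ shrink lam (GD lam x0) = shrink lam x0 := by
  refine ⟨?_, shrink_GD_two_dim hord hpos h0 h1⟩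
  have hev : (fun k : ℕ => (∏ j ∈ Finset.range k, shrink lam ((GD lam)^[j] x0)) ^ ((k : ℝ)⁻¹))
      =ᶠ[atTop] fun _ => shrink lam x0 := by
    filter_upwards [eventually_ne_atTop 0] with k hk
    simp only [shrink_iterate_GD_two_dim hord hpos h0 h1, Finset.prod_const, Finset.card_range]
    exact Real.pow_rpow_inv_natCast (shrink_nonneg lam x0) hk
  rw [rocGD, limsup_congr hev, limsup_const]

end
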